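/- arXiv:2407.08158 — 5 statements merged into one kernel-verified Lean document; each statement's English description precedes it below -/
import Mathlib

section
/- Let k ≥ 2 and n₁, n₂ ≥ 1. The f-polynomial of the k-cut complex of the disjoint union of two complete graphs satisfies f(Δ_k(K_{n₁}+K_{n₂}),x) = Σ_{j=k}^{n₁+n₂} ( C(n₁+n₂,j) − C(n₁,j) − C(n₂,j) ) x^{n₁+n₂−j}, where C(a,b) denotes the binomial coefficient (equal to 0 when b > a). -/
open SimpleGraph Polynomial Finset

/-- `σ` is a face of the `k`-cut complex of `G`. -/
def isCutFace {V : Type*} [Fintype V] [DecidableEq V] (G : SimpleGraph V) (k : ℕ)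
    (σ : Finset V) : Prop :=
  ∃ S : Finset V, S ⊆ σᶜ ∧ S.card = k ∧ ¬ (G.induce (S : Set V)).Connected

open Classical in
/-- The f-polynomial of the k-cut complex of G. -/
noncomputable def cutFPoly {V : Type*} [Fintype V] [DecidableEq V] (G : SimpleGraph V) (k : ℕ) :
    Polynomial ℤ :=
  ∑ σ ∈ Finset.univ.filter (fun σ => isCutFace G k σ), (X : Polynomial ℤ) ^ σ.card


/-- In a disjoint union of complete graphs, an induced subgraph on vertices from both parts is
disconnected. -/
lemma not_connected_induce_top_sum_top {α β : Type*} {S : Set (α ⊕ β)} {a : α} {b : β}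
    (ha : Sum.inl a ∈ S) (hb : Sum.inr b ∈ S) :
    ¬ (((⊤ : SimpleGraph α) ⊕g (⊤ : SimpleGraph β)).induce S).Connected := by
  intro h
  have key : ∀ u v : S, (((⊤ : SimpleGraph α) ⊕g (⊤ : SimpleGraph β)).induce S).Walk u v →
      (u : α ⊕ β).isLeft = (v : α ⊕ β).isLeft := by
    intro u v w
    induction w with
    | nil => rfl
    | @cons x y z hadj _ ih =>
      rw [← ih]
      obtain ⟨x | x, hx⟩ := x <;> obtain ⟨y | y, hy⟩ := y <;> simp_all
  obtain ⟨w⟩ := h.preconnected ⟨_, ha⟩ ⟨_, hb⟩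
  simpa using key _ _ w

/-- A nonempty disconnected induced subgraph of a disjoint union of complete graphs has vertices
in both parts. -/
lemma exists_inl_inr_of_not_connected_induce {α β : Type*} {S : Set (α ⊕ β)} (hS : S.Nonempty)
    (h : ¬ (((⊤ : SimpleGraph α) ⊕g (⊤ : SimpleGraph β)).induce S).Connected) :
    (∃ a, Sum.inl a ∈ S) ∧ ∃ b, Sum.inr b ∈ S := by
  by_contra hne
  apply h
  have : Nonempty S := hS.to_subtype
  refine ⟨fun u v => ?_⟩
  by_cases huv : u = v
  · rw [huv]
  · apply SimpleGraph.Adj.reachable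
    obtain ⟨u | u, hu⟩ := u <;> obtain ⟨v | v, hv⟩ := v
    · simpa using huv
    · exact absurd ⟨⟨u, hu⟩, v, hv⟩ hne
    · exact absurd ⟨⟨v, hv⟩, u, hu⟩ hne
    · simpa using huv

lemma isCutFace_top_sum_top_iff {α β : Type*} [Fintype α] [Fintype β] [DecidableEq α]
    [DecidableEq β] {k : ℕ} (hk : 2 ≤ k) (σ : Finset (α ⊕ β)) :
    isCutFace ((⊤ : SimpleGraph α) ⊕g (⊤ : SimpleGraph β)) k σ ↔
      k ≤ σᶜ.card ∧ (∃ a, Sum.inl a ∈ σᶜ) ∧ ∃ b, Sum.inr b ∈ σᶜ := by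
  constructor
  · rintro ⟨S, hS, hc, hdis⟩
    have hne : S.Nonempty := Finset.card_pos.mp (by omega)
    obtain ⟨⟨a, ha⟩, b, hb⟩ := exists_inl_inr_of_not_connected_induce (by simpa using hne) hdis
    exact ⟨hc ▸ Finset.card_le_card hS, ⟨a, hS ha⟩, b, hS hb⟩
  · rintro ⟨hc, ⟨a, ha⟩, b, hb⟩
    have hsub : ({Sum.inl a, Sum.inr b} : Finset (α ⊕ β)) ⊆ σᶜ := by
      simp only [Finset.insert_subset_iff, Finset.singleton_subset_iff]
      exact ⟨ha, hb⟩
    obtain ⟨S, h₁, h₂, h₃⟩ := Finset.exists_subsuperset_card_eq hsub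
      (Finset.card_le_two.trans hk) hc
    exact ⟨S, h₂, h₃, not_connected_induce_top_sum_top (a := a) (b := b)
      (h₁ (by simp)) (h₁ (by simp))⟩

open Classical in
/-- The number of `j`-subsets of a disjoint union that meet both parts. -/
lemma card_filter_meets_both_parts {α β : Type*} [Fintype α] [Fintype β] {j : ℕ} (hj : j ≠ 0) :
    (#{τ : Finset (α ⊕ β) | τ.card = j ∧ (∃ a, Sum.inl a ∈ τ) ∧ ∃ b, Sum.inr b ∈ τ} : ℤ) =
      (Fintype.card α + Fintype.card β).choose j - (Fintype.card α).choose j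
        - (Fintype.card β).choose j := by
  set A := ((univ : Finset α).map Function.Embedding.inl : Finset (α ⊕ β)).powersetCard j
  set B := ((univ : Finset β).map Function.Embedding.inr : Finset (α ⊕ β)).powersetCard j
  set M : Finset (Finset (α ⊕ β)) :=
    {τ | τ.card = j ∧ (∃ a, Sum.inl a ∈ τ) ∧ ∃ b, Sum.inr b ∈ τ}
  have hA : ∀ τ, τ ∈ A ↔ τ.card = j ∧ ¬ ∃ b, Sum.inr b ∈ τ := by
    intro τ
    simp [A, Finset.mem_powersetCard, Finset.subset_iff, and_comm]
  have hB : ∀ τ, τ ∈ B ↔ τ.card = j ∧ ¬ ∃ a, Sum.inl a ∈ τ := by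
    intro τ
    simp [B, Finset.mem_powersetCard, Finset.subset_iff, and_comm]
  have hM : ∀ τ, τ ∈ M ↔ τ.card = j ∧ (∃ a, Sum.inl a ∈ τ) ∧ ∃ b, Sum.inr b ∈ τ := by
    simp [M]
  have hAB : Disjoint A B := by
    rw [Finset.disjoint_left]
    intro τ h₁ h₂
    rw [hA] at h₁
    rw [hB] at h₂
    obtain ⟨x | x, hx⟩ := Finset.card_pos.mp (Nat.pos_of_ne_zero (h₁.1 ▸ hj))
    · exact h₂.2 ⟨x, hx⟩
    · exact h₁.2 ⟨x, hx⟩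
  have hMAB : Disjoint M (A ∪ B) := by
    rw [Finset.disjoint_left]
    intro τ h₁ h₂
    rw [Finset.mem_union, hA, hB] at h₂
    rw [hM] at h₁
    tauto
  have hunion : M ∪ (A ∪ B) = (univ : Finset (α ⊕ β)).powersetCard j := by
    ext τ
    rw [Finset.mem_union, Finset.mem_union, hA, hB, hM, Finset.mem_powersetCard_univ]
    tauto
  have hcard := congrArg Finset.card hunion
  rw [Finset.card_union_of_disjoint hMAB, Finset.card_union_of_disjoint hAB] at hcard
  simp only [A, B, Finset.card_powersetCard, Finset.card_map, Finset.card_univ,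
    Fintype.card_sum] at hcard
  omega

theorem fPolynomial_of_cut_complex_of_disjoint_complete_graphs (k n₁ n₂ : ℕ)
    (hk : 2 ≤ k) (h₁ : 1 ≤ n₁) (h₂ : 1 ≤ n₂) :
    cutFPoly ((⊤ : SimpleGraph (Fin n₁)) ⊕g (⊤ : SimpleGraph (Fin n₂))) k =
      ∑ j ∈ Finset.Icc k (n₁ + n₂),
        C (((n₁ + n₂).choose j : ℤ) - (n₁.choose j : ℤ) - (n₂.choose j : ℤ)) *
          X ^ (n₁ + n₂ - j) := by
  classical
  have hle : ∀ τ : Finset (Fin n₁ ⊕ Fin n₂), τ.card ≤ n₁ + n₂ := fun τ => by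
    simpa using τ.card_le_univ
  unfold cutFPoly
  simp only [isCutFace_top_sum_top_iff hk]
  rw [← Finset.sum_fiberwise_of_maps_to (t := Finset.Icc k (n₁ + n₂)) (g := fun σ => σᶜ.card)
    (fun σ hσ => Finset.mem_Icc.mpr ⟨(Finset.mem_filter.mp hσ).2.1, hle _⟩)]
  refine Finset.sum_congr rfl fun j hj => ?_
  rw [Finset.mem_Icc] at hj
  have hcard := card_filter_meets_both_parts (α := Fin n₁) (β := Fin n₂) (j := j) (by omega)
  rw [Fintype.card_fin, Fintype.card_fin] at hcard
  rw [← hcard, Finset.sum_congr rfl (g := fun _ => (X : ℤ[X]) ^ (n₁ + n₂ - j))]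
  · rw [Finset.sum_const, nsmul_eq_mul]
    congr 1
    rw [map_natCast, Nat.cast_inj]
    refine Finset.card_bij' (fun σ _ => σᶜ) (fun τ _ => τᶜ) ?_ ?_ ?_ ?_
    · simp +contextual
    · intro τ hτ
      simp only [Finset.mem_filter, Finset.mem_univ, true_and, compl_compl] at hτ ⊢
      exact ⟨⟨hτ.1 ▸ hj.1, hτ.2⟩, hτ.1⟩
    · simp
    · simp
  · intro σ hσ
    have hσj := (Finset.mem_filter.mp hσ).2
    have := σ.card_add_card_compl
    simp only [Fintype.card_sum, Fintype.card_fin] at this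
    congr 1
    omega
end

section
/- Let k ≥ 2 and let G₁, G₂ be finite simple graphs on disjoint vertex sets of sizes n₁ and n₂ respectively. Then f(Δ_k(G₁+G₂),x) = x^{n₂}·f(Δ_k(G₁),x) + x^{n₁}·f(Δ_k(G₂),x) + Σ_{j=k}^{n₁+n₂} ( C(n₁+n₂,j) − C(n₁,j) − C(n₂,j) ) x^{n₁+n₂−j}, where C(a,b) denotes the binomial coefficient (equal to 0 when b > a). -/
open SimpleGraph Polynomial Finset

theorem isCutFace_compl {V : Type*} [Fintype V] [DecidableEq V] {G : SimpleGraph V} {k : ℕ}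
    {τ : Finset V} : isCutFace G k τᶜ ↔
      ∃ S : Finset V, S ⊆ τ ∧ S.card = k ∧ ¬ (G.induce (S : Set V)).Connected := by
  simp [isCutFace]

theorem isCutFace.le_card {V : Type*} [Fintype V] [DecidableEq V] {G : SimpleGraph V} {k : ℕ}
    {τ : Finset V} (h : isCutFace G k τᶜ) : k ≤ τ.card := by
  obtain ⟨S, hS, rfl, -⟩ := isCutFace_compl.1 h
  exact card_le_card hS

/-- A graph embedding restricts to an isomorphism from an induced subgraph to its image. -/
noncomputable def induceMapIso {V W : Type*} {G : SimpleGraph V} {H : SimpleGraph W} (f : G ↪g H)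
    (S : Finset V) :
    G.induce (S : Set V) ≃g H.induce ((S.map f.toEmbedding : Finset W) : Set W) where
  toEquiv := (Equiv.Set.image f (S : Set V) f.injective).trans (Equiv.setCongr (by simp))
  map_rel_iff' := by
    intro a b
    exact f.map_adj_iff

theorem isCutFace_compl_map {V W : Type*} [Fintype V] [DecidableEq V] [Fintype W] [DecidableEq W]
    {G : SimpleGraph V} {H : SimpleGraph W} (f : G ↪g H) (k : ℕ) (τ : Finset V) :
    isCutFace H k (τ.map f.toEmbedding)ᶜ ↔ isCutFace G k τᶜ := by
  rw [isCutFace_compl, isCutFace_compl]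
  constructor
  · rintro ⟨S, hS, hk, hc⟩
    obtain ⟨T, hT, rfl⟩ := subset_map_iff.1 hS
    exact ⟨T, hT, by simpa using hk, fun h => hc ((induceMapIso f T).connected_iff.1 h)⟩
  · rintro ⟨T, hT, hk, hc⟩
    exact ⟨T.map f.toEmbedding, map_subset_map.2 hT, by simpa using hk,
      fun h => hc ((induceMapIso f T).connected_iff.2 h)⟩

theorem isCutFace_compl_of_inl_mem_of_inr_mem {V W : Type*} [Fintype V] [DecidableEq V]
    [Fintype W] [DecidableEq W] (G : SimpleGraph V) (H : SimpleGraph W) {k : ℕ} (hk : 2 ≤ k)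
    {τ : Finset (V ⊕ W)} {v : V} {w : W} (hv : Sum.inl v ∈ τ) (hw : Sum.inr w ∈ τ)
    (hτ : k ≤ τ.card) : isCutFace (G ⊕g H) k τᶜ := by
  have hsub : ({Sum.inl v, Sum.inr w} : Finset (V ⊕ W)) ⊆ τ := by
    simp [insert_subset_iff, hv, hw]
  obtain ⟨S, hS, hSτ, hcard⟩ := exists_subsuperset_card_eq hsub (card_le_two.trans hk) hτ
  refine isCutFace_compl.2 ⟨S, hSτ, hcard, fun hc => ?_⟩
  exact not_reachable_sum_inl_inr v w <|
    (hc.preconnected ⟨Sum.inl v, hS (by simp)⟩ ⟨Sum.inr w, hS (by simp)⟩).map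
      (Embedding.induce _).toHom

open Classical in
/-- The generating function, by size of the complement, of the vertex sets with at least `k`
elements that are not complements of faces of the `k`-cut complex. -/
noncomputable def nonCutFPoly {V : Type*} [Fintype V] [DecidableEq V] (G : SimpleGraph V)
    (k : ℕ) : Polynomial ℤ :=
  ∑ τ : Finset V, if k ≤ τ.card ∧ ¬ isCutFace G k τᶜ then X ^ (Fintype.card V - τ.card) else 0

theorem cutFPoly_add_nonCutFPoly {V : Type*} [Fintype V] [DecidableEq V] (G : SimpleGraph V)
    (k : ℕ) : cutFPoly G k + nonCutFPoly G k =
      ∑ j ∈ Icc k (Fintype.card V),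
        C ((Fintype.card V).choose j : ℤ) * X ^ (Fintype.card V - j) := by
  classical
  have hcut : cutFPoly G k =
      ∑ τ : Finset V, if isCutFace G k τᶜ then X ^ (Fintype.card V - τ.card) else 0 := by
    rw [cutFPoly, sum_filter, ← Equiv.sum_comp (compl_involutive (α := Finset V)).toPerm]
    simp [card_compl]
  have hsum (τ : Finset V) :
      ((if isCutFace G k τᶜ then X ^ (Fintype.card V - τ.card) else 0) +
        if k ≤ τ.card ∧ ¬ isCutFace G k τᶜ then X ^ (Fintype.card V - τ.card) else 0) =
      (if k ≤ τ.card then X ^ (Fintype.card V - τ.card) else 0 : Polynomial ℤ) := by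
    by_cases h : isCutFace G k τᶜ
    · simp [h, h.le_card]
    · simp [h]
  rw [hcut, nonCutFPoly, ← sum_add_distrib, sum_congr rfl fun τ _ => hsum τ, ← powerset_univ,
    sum_powerset_apply_card
      (fun j => (if k ≤ j then X ^ (Fintype.card V - j) else 0 : Polynomial ℤ))]
  simp only [smul_ite, smul_zero, card_univ]
  rw [← sum_filter]
  refine sum_congr ?_ fun j _ => by simp
  ext j
  simp
  omega

theorem X_pow_mul_sum_choose (k n m : ℕ) :
    (X : Polynomial ℤ) ^ m * ∑ j ∈ Icc k n, C (n.choose j : ℤ) * X ^ (n - j) =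
      ∑ j ∈ Icc k (n + m), C (n.choose j : ℤ) * X ^ (n + m - j) := by
  rw [mul_sum, ← sum_subset (Icc_subset_Icc_right (Nat.le_add_right n m))]
  · refine sum_congr rfl fun j hj => ?_
    rw [Nat.sub_add_comm (mem_Icc.1 hj).2, pow_add]
    ring
  · intro j hj hj'
    have : n < j := by
      simp only [mem_Icc] at hj hj'
      omega
    simp [Nat.choose_eq_zero_of_lt this]

theorem nonCutFPoly_sum {V W : Type*} [Fintype V] [DecidableEq V] [Fintype W] [DecidableEq W]
    (G : SimpleGraph V) (H : SimpleGraph W) {k : ℕ} (hk : 2 ≤ k) :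
    nonCutFPoly (G ⊕g H) k =
      X ^ Fintype.card W * nonCutFPoly G k + X ^ Fintype.card V * nonCutFPoly H k := by
  classical
  have hinl (A : Finset V) :
      isCutFace (G ⊕g H) k (A.disjSum ∅)ᶜ ↔ isCutFace G k Aᶜ := by
    rw [disjSum_empty]
    exact isCutFace_compl_map Embedding.sumInl k A
  have hinr (B : Finset W) :
      isCutFace (G ⊕g H) k ((∅ : Finset V).disjSum B)ᶜ ↔ isCutFace H k Bᶜ := by
    rw [empty_disjSum]
    exact isCutFace_compl_map Embedding.sumInr k B
  have hsplit (A : Finset V) (B : Finset W) :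
      (if k ≤ (A.disjSum B).card ∧ ¬ isCutFace (G ⊕g H) k (A.disjSum B)ᶜ then
        X ^ (Fintype.card (V ⊕ W) - (A.disjSum B).card) else 0 : Polynomial ℤ) =
      (if B = ∅ then X ^ Fintype.card W *
        (if k ≤ A.card ∧ ¬ isCutFace G k Aᶜ then X ^ (Fintype.card V - A.card) else 0) else 0) +
      (if A = ∅ then X ^ Fintype.card V *
        (if k ≤ B.card ∧ ¬ isCutFace H k Bᶜ then X ^ (Fintype.card W - B.card) else 0) else 0) := by
    have hk0 : ¬ k ≤ 0 := by omega
    have hA := card_le_univ A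
    have hB := card_le_univ B
    rcases B.eq_empty_or_nonempty with rfl | ⟨w, hw⟩
    · rw [hinl]
      simp only [card_disjSum, card_empty, add_zero, hk0, false_and, if_false, mul_zero, ite_self,
        if_true, mul_ite, ← pow_add, Fintype.card_sum]
      rw [← Nat.add_sub_assoc hA, add_comm (Fintype.card W)]
    rcases A.eq_empty_or_nonempty with rfl | ⟨v, hv⟩
    · rw [hinr]
      simp only [card_disjSum, card_empty, zero_add, hk0, false_and, if_false, mul_zero, ite_self,
        if_true, mul_ite, ← pow_add, Fintype.card_sum]
      rw [← Nat.add_sub_assoc hB]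
    · rw [if_neg, if_neg (ne_empty_of_mem hw), if_neg (ne_empty_of_mem hv), add_zero]
      rintro ⟨hcard, hface⟩
      exact hface (isCutFace_compl_of_inl_mem_of_inr_mem G H hk (inl_mem_disjSum.2 hv)
        (inr_mem_disjSum.2 hw) hcard)
  rw [nonCutFPoly, ← Equiv.sum_comp (sumEquiv (α := V) (β := W)).symm.toEquiv,
    Fintype.sum_prod_type]
  refine (sum_congr rfl fun A _ => sum_congr rfl fun B _ => hsplit A B).trans ?_
  simp only [sum_add_distrib]
  congr 1
  · simp [nonCutFPoly, mul_sum]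
  · rw [sum_comm]
    simp [nonCutFPoly, mul_sum]

theorem fPolynomial_of_cut_complex_of_disjoint_union (k n₁ n₂ : ℕ) (hk : 2 ≤ k)
    (G₁ : SimpleGraph (Fin n₁)) (G₂ : SimpleGraph (Fin n₂)) :
    cutFPoly (G₁ ⊕g G₂) k =
      X ^ n₂ * cutFPoly G₁ k + X ^ n₁ * cutFPoly G₂ k +
        ∑ j ∈ Finset.Icc k (n₁ + n₂),
          C (((n₁ + n₂).choose j : ℤ) - (n₁.choose j : ℤ) - (n₂.choose j : ℤ)) *
            X ^ (n₁ + n₂ - j) := by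
  have h := cutFPoly_add_nonCutFPoly (G₁ ⊕g G₂) k
  have h₁ := cutFPoly_add_nonCutFPoly G₁ k
  have h₂ := cutFPoly_add_nonCutFPoly G₂ k
  have hsum := nonCutFPoly_sum G₁ G₂ hk
  have hx₁ := X_pow_mul_sum_choose k n₁ n₂
  have hx₂ := X_pow_mul_sum_choose k n₂ n₁
  simp only [Fintype.card_sum, Fintype.card_fin] at h h₁ h₂ hsum
  rw [add_comm n₂ n₁] at hx₂
  simp only [C_sub, sub_mul, sum_sub_distrib]
  rw [← h, ← hx₁, ← hx₂, ← h₁, ← h₂, hsum]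
  ring
end

section
/- Let k ≥ 2 and let G₁, G₂ be finite simple graphs on disjoint vertex sets of sizes n₁ and n₂ respectively. Then h(Δ_k(G₁+G₂),x) = x^{n₂}·h(Δ_k(G₁),x) + x^{n₁}·h(Δ_k(G₂),x) + h(Δ_k(K_{n₁}+K_{n₂}),x). -/
open SimpleGraph Polynomial Finset

open Classical in
noncomputable def cutHPoly {V : Type*} [Fintype V] [DecidableEq V] (G : SimpleGraph V) (k : ℕ) :
    Polynomial ℤ :=
  ∑ σ ∈ Finset.univ.filter (fun σ => isCutFace G k σ),
    (X : Polynomial ℤ) ^ σ.card * (1 - X) ^ (Fintype.card V - k - σ.card)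

/-- Sets of vertices identified by a graph embedding induce isomorphic subgraphs. -/
lemma connected_induce_map_iff {V W : Type*} {G : SimpleGraph V} {H : SimpleGraph W}
    (f : G ↪g H) (S : Finset V) :
    (H.induce (S.map f.toEmbedding : Set W)).Connected ↔ (G.induce (S : Set V)).Connected := by
  have e : G.induce (S : Set V) ≃g H.induce (S.map f.toEmbedding : Set W) :=
    { toEquiv := (Equiv.Set.image f (S : Set V) f.injective).trans
        (Equiv.setCongr (by simp))
      map_rel_iff' := by
        intro a b
        exact f.map_adj_iff }
  exact e.connected_iff.symm

/-- The set `(σᶜ.map f)ᶜ`, whose complement is the image under `f` of the complement of `σ`. -/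
def complMapCompl {V W : Type*} [Fintype V] [DecidableEq V] [Fintype W] [DecidableEq W]
    (f : V ↪ W) (σ : Finset V) : Finset W :=
  (σᶜ.map f)ᶜ

section complMapCompl

variable {V W : Type*} [Fintype V] [DecidableEq V] [Fintype W] [DecidableEq W]

lemma complMapCompl_injective (f : V ↪ W) : Function.Injective (complMapCompl f) :=
  compl_injective.comp ((Finset.map_injective f).comp compl_injective)

lemma notMem_complMapCompl {f : V ↪ W} {σ : Finset V} {w : W} :
    w ∉ complMapCompl f σ ↔ ∃ v, v ∉ σ ∧ f v = w := by
  simp [complMapCompl]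

lemma exists_complMapCompl_eq {f : V ↪ W} {τ : Finset W} (h : ∀ w ∉ τ, w ∈ Set.range f) :
    ∃ σ, complMapCompl f σ = τ := by
  refine ⟨τ.preimage f f.injective.injOn, ?_⟩
  ext w
  rw [← not_iff_not, notMem_complMapCompl]
  constructor
  · rintro ⟨v, hv, rfl⟩
    simpa using hv
  · intro hw
    obtain ⟨v, rfl⟩ := h w hw
    exact ⟨v, by simpa using hw, rfl⟩

lemma card_complMapCompl (f : V ↪ W) (σ : Finset V) :
    (complMapCompl f σ).card = Fintype.card W - Fintype.card V + σ.card := by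
  have h₁ := Fintype.card_le_of_embedding f
  have h₂ := Finset.card_le_univ σ
  rw [complMapCompl, Finset.card_compl, Finset.card_map, Finset.card_compl]
  omega

lemma isCutFace_complMapCompl {G : SimpleGraph V} {H : SimpleGraph W} (f : G ↪g H) {k : ℕ}
    {σ : Finset V} : isCutFace H k (complMapCompl f.toEmbedding σ) ↔ isCutFace G k σ := by
  simp only [isCutFace, complMapCompl, compl_compl]
  constructor
  · rintro ⟨S, hS, hcard, hconn⟩
    obtain ⟨T, hT, rfl⟩ := Finset.subset_map_iff.mp hS
    exact ⟨T, hT, by simpa using hcard, by rwa [connected_induce_map_iff] at hconn⟩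
  · rintro ⟨T, hT, hcard, hconn⟩
    exact ⟨T.map f.toEmbedding, Finset.map_subset_map.mpr hT, by simpa using hcard,
      by rwa [connected_induce_map_iff]⟩

open Classical in
lemma sum_image_complMapCompl (G : SimpleGraph V) (f : V ↪ W) (k : ℕ) :
    ∑ σ ∈ (Finset.univ.filter (isCutFace G k)).image (complMapCompl f),
      (X : Polynomial ℤ) ^ σ.card * (1 - X) ^ (Fintype.card W - k - σ.card) =
    X ^ (Fintype.card W - Fintype.card V) * cutHPoly G k := by
  rw [Finset.sum_image (complMapCompl_injective f).injOn, cutHPoly, Finset.mul_sum]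
  refine Finset.sum_congr rfl fun σ _ => ?_
  have h := Fintype.card_le_of_embedding f
  rw [card_complMapCompl, pow_add, mul_assoc]
  congr 3
  omega

lemma not_isCutFace_top {k : ℕ} (hk : k ≠ 0) (σ : Finset V) :
    ¬ isCutFace (⊤ : SimpleGraph V) k σ := by
  rintro ⟨S, -, hcard, hconn⟩
  have : Nonempty (S : Set V) := by
    obtain ⟨v, hv⟩ := Finset.card_pos.mp (by omega : 0 < S.card)
    exact ⟨v, hv⟩
  apply hconn
  rw [SimpleGraph.induce_top]
  exact SimpleGraph.connected_top

lemma isCutFace.exists_notMem {G : SimpleGraph V} {k : ℕ} (hk : k ≠ 0) {σ : Finset V}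
    (h : isCutFace G k σ) : ∃ v, v ∉ σ := by
  obtain ⟨S, hS, hcard, -⟩ := h
  obtain ⟨v, hv⟩ := Finset.card_pos.mp (by omega : 0 < S.card)
  exact ⟨v, by simpa using hS hv⟩

end complMapCompl

section sum

lemma not_connected_induce_sum {V W : Type*} (G : SimpleGraph V) (H : SimpleGraph W) {S : Set (V ⊕ W)} {v : V}
    {w : W} (hv : Sum.inl v ∈ S) (hw : Sum.inr w ∈ S) : ¬ ((G ⊕g H).induce S).Connected := by
  intro h
  have hr := (h.preconnected ⟨_, hv⟩ ⟨_, hw⟩).map (SimpleGraph.Embedding.induce S).toHom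
  exact SimpleGraph.not_reachable_sum_inl_inr v w hr

variable {V W : Type*} [Fintype V] [DecidableEq V] [Fintype W] [DecidableEq W]

/-- When the complement of `σ` meets both sides of a disjoint union, only its size matters. -/
lemma isCutFace_sum_iff_of_notMem (G : SimpleGraph V) (H : SimpleGraph W) {k : ℕ} (hk : 2 ≤ k)
    {σ : Finset (V ⊕ W)} {v : V} {w : W} (hv : Sum.inl v ∉ σ) (hw : Sum.inr w ∉ σ) :
    isCutFace (G ⊕g H) k σ ↔ k ≤ σᶜ.card := by
  constructor
  · rintro ⟨S, hS, rfl, -⟩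
    exact Finset.card_le_card hS
  · intro h
    have hsub : ({Sum.inl v, Sum.inr w} : Finset (V ⊕ W)) ⊆ σᶜ := by
      simp [Finset.insert_subset_iff, hv, hw]
    obtain ⟨S, hS₁, hS₂, hcard⟩ := Finset.exists_subsuperset_card_eq hsub
      (Finset.card_le_two.trans hk) h
    exact ⟨S, hS₂, hcard, not_connected_induce_sum G H (v := v) (w := w)
      (hS₁ (by simp)) (hS₁ (by simp))⟩

lemma isCutFace_sum_top_top {k : ℕ} (hk : k ≠ 0) {σ : Finset (V ⊕ W)}
    (h : isCutFace ((⊤ : SimpleGraph V) ⊕g (⊤ : SimpleGraph W)) k σ) :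
    (∃ v, Sum.inl v ∉ σ) ∧ ∃ w, Sum.inr w ∉ σ := by
  constructor <;> by_contra! hσ
  · obtain ⟨τ, rfl⟩ := exists_complMapCompl_eq (τ := σ)
      (f := (SimpleGraph.Embedding.sumInr (G := (⊤ : SimpleGraph V))
        (H := (⊤ : SimpleGraph W))).toEmbedding)
      (by rintro (v | w) hx; exacts [absurd (hσ v) hx, ⟨w, rfl⟩])
    exact not_isCutFace_top hk τ ((isCutFace_complMapCompl _).mp h)
  · obtain ⟨τ, rfl⟩ := exists_complMapCompl_eq (τ := σ)
      (f := (SimpleGraph.Embedding.sumInl (G := (⊤ : SimpleGraph V))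
        (H := (⊤ : SimpleGraph W))).toEmbedding)
      (by rintro (v | w) hx; exacts [⟨v, rfl⟩, absurd (hσ w) hx])
    exact not_isCutFace_top hk τ ((isCutFace_complMapCompl _).mp h)

open Classical in
lemma filter_isCutFace_sum (G : SimpleGraph V) (H : SimpleGraph W) {k : ℕ} (hk : 2 ≤ k) :
    Finset.univ.filter (isCutFace (G ⊕g H) k) =
      (Finset.univ.filter (isCutFace G k)).image (complMapCompl .inl) ∪
        (Finset.univ.filter (isCutFace H k)).image (complMapCompl .inr) ∪
        Finset.univ.filter (isCutFace ((⊤ : SimpleGraph V) ⊕g (⊤ : SimpleGraph W)) k) := by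
  ext σ
  simp only [Finset.mem_union, Finset.mem_image, Finset.mem_filter, Finset.mem_univ, true_and]
  constructor
  · intro h
    by_cases hv : ∃ v, Sum.inl v ∉ σ
    · by_cases hw : ∃ w, Sum.inr w ∉ σ
      · obtain ⟨v, hv⟩ := hv
        obtain ⟨w, hw⟩ := hw
        rw [isCutFace_sum_iff_of_notMem _ _ hk hv hw] at h ⊢
        exact .inr h
      · push Not at hw
        obtain ⟨τ, rfl⟩ := exists_complMapCompl_eq (τ := σ) (f := .inl)
          (by rintro (v | w) hx; exacts [⟨v, rfl⟩, absurd (hw w) hx])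
        exact .inl (.inl ⟨τ, (isCutFace_complMapCompl SimpleGraph.Embedding.sumInl).mp h, rfl⟩)
    · push Not at hv
      obtain ⟨τ, rfl⟩ := exists_complMapCompl_eq (τ := σ) (f := .inr)
        (by rintro (v | w) hx; exacts [absurd (hv v) hx, ⟨w, rfl⟩])
      exact .inl (.inr ⟨τ, (isCutFace_complMapCompl SimpleGraph.Embedding.sumInr).mp h, rfl⟩)
  · rintro ((⟨τ, hτ, rfl⟩ | ⟨τ, hτ, rfl⟩) | h)
    · exact (isCutFace_complMapCompl SimpleGraph.Embedding.sumInl).mpr hτ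
    · exact (isCutFace_complMapCompl SimpleGraph.Embedding.sumInr).mpr hτ
    · obtain ⟨⟨v, hv⟩, w, hw⟩ := isCutFace_sum_top_top (by omega) h
      rwa [isCutFace_sum_iff_of_notMem _ _ hk hv hw] at h ⊢

/-- The `h`-polynomial of the cut complex of a disjoint union of graphs on arbitrary vertex
types. -/
lemma cutHPoly_sum (G : SimpleGraph V) (H : SimpleGraph W) {k : ℕ} (hk : 2 ≤ k) :
    cutHPoly (G ⊕g H) k =
      X ^ Fintype.card W * cutHPoly G k + X ^ Fintype.card V * cutHPoly H k +
        cutHPoly ((⊤ : SimpleGraph V) ⊕g (⊤ : SimpleGraph W)) k := by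
  classical
  have hk₀ : k ≠ 0 := by omega
  rw [cutHPoly, filter_isCutFace_sum G H hk, Finset.sum_union, Finset.sum_union,
    sum_image_complMapCompl, sum_image_complMapCompl, ← cutHPoly, Fintype.card_sum,
    Nat.add_sub_cancel_left, Nat.add_sub_cancel]
  · rw [Finset.disjoint_left]
    intro σ h₁ h₂
    simp only [Finset.mem_image, Finset.mem_filter, Finset.mem_univ, true_and] at h₁ h₂
    obtain ⟨τ, hτ, rfl⟩ := h₁
    obtain ⟨τ', -, h⟩ := h₂
    obtain ⟨v, hv⟩ := hτ.exists_notMem hk₀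
    have hn : Sum.inl v ∉ complMapCompl (.inl : V ↪ V ⊕ W) τ :=
      notMem_complMapCompl.mpr ⟨v, hv, rfl⟩
    rw [← h, notMem_complMapCompl] at hn
    simp at hn
  · rw [Finset.disjoint_left]
    intro σ h₁ h₂
    obtain ⟨⟨v, hv⟩, w, hw⟩ := isCutFace_sum_top_top hk₀ (Finset.mem_filter.mp h₂).2
    simp only [Finset.mem_union, Finset.mem_image, Finset.mem_filter, Finset.mem_univ,
      true_and] at h₁
    obtain ⟨τ, -, rfl⟩ | ⟨τ, -, rfl⟩ := h₁
    · simp [notMem_complMapCompl] at hw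
    · simp [notMem_complMapCompl] at hv

end sum

theorem hPolynomial_of_cut_complex_of_disjoint_union (k n₁ n₂ : ℕ) (hk : 2 ≤ k)
    (G₁ : SimpleGraph (Fin n₁)) (G₂ : SimpleGraph (Fin n₂)) :
    cutHPoly (G₁ ⊕g G₂) k =
      X ^ n₂ * cutHPoly G₁ k + X ^ n₁ * cutHPoly G₂ k +
        cutHPoly ((⊤ : SimpleGraph (Fin n₁)) ⊕g (⊤ : SimpleGraph (Fin n₂))) k := by
  simpa using cutHPoly_sum G₁ G₂ hk
end

section
/- Let k ≥ 2 and m, n ≥ 1 with m + n ≥ k. Then h(Δ_k(K_m+K_n),x) = Σ_{j=0}^{m+n−k} C(k−1+j,k−1) x^j − x^n·A − x^m·B, where A = Σ_{j=0}^{m−k} C(k−1+j,k−1) x^j if m ≥ k and A = 0 if m < k, and B = Σ_{j=0}^{n−k} C(k−1+j,k−1) x^j if n ≥ k and B = 0 if n < k. -/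
open SimpleGraph Polynomial Finset

theorem sum_range_choose_mul_pow_mul_one_sub_pow (k d : ℕ) (hk : 1 ≤ k) :
    ∑ i ∈ range (d + 1),
        ((d + k).choose i : Polynomial ℤ) * (X ^ i * (1 - X) ^ (d - i)) =
      ∑ j ∈ range (d + 1), C (((k - 1 + j).choose (k - 1) : ℤ)) * X ^ j := by
  induction d with
  | zero => simp
  | succ d ih =>
    rw [sum_range_succ (fun j => C (((k - 1 + j).choose (k - 1) : ℤ)) * X ^ j), ← ih]
    have hsymm : (k - 1 + (d + 1)).choose (k - 1) = (d + k).choose (d + 1) := by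
      rw [show k - 1 + (d + 1) = d + k by lia]
      exact Nat.choose_symm_of_eq_add (by lia)
    have hpascal : ∀ i ∈ range (d + 1),
        ((d + 1 + k).choose (i + 1) : Polynomial ℤ) * (X ^ (i + 1) * (1 - X) ^ (d + 1 - (i + 1))) =
          X * (((d + k).choose i : Polynomial ℤ) * (X ^ i * (1 - X) ^ (d - i))) +
          ((d + k).choose (i + 1) : Polynomial ℤ) * (X ^ (i + 1) * (1 - X) ^ (d - i)) := by
      intro i _
      rw [show d + 1 + k = d + k + 1 by lia, Nat.choose_succ_succ, Nat.add_sub_add_right]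
      push_cast
      ring
    have hshift : ∑ i ∈ range (d + 1),
          ((d + k).choose (i + 1) : Polynomial ℤ) * (X ^ (i + 1) * (1 - X) ^ (d - i)) +
          (1 - X) ^ (d + 1) =
        (1 - X) * ∑ i ∈ range (d + 1),
          ((d + k).choose i : Polynomial ℤ) * (X ^ i * (1 - X) ^ (d - i)) +
          ((d + k).choose (d + 1) : Polynomial ℤ) * X ^ (d + 1) := by
      have h := sum_range_succ' (fun i =>
        ((d + k).choose i : Polynomial ℤ) * (X ^ i * (1 - X) ^ (d + 1 - i))) (d + 1)
      rw [sum_range_succ] at h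
      simp only [Nat.add_sub_add_right, Nat.sub_self, Nat.choose_zero_right, pow_zero, mul_one,
        one_mul, Nat.cast_one, Nat.sub_zero] at h
      rw [← h, mul_sum]
      congr 1
      refine sum_congr rfl fun i hi => ?_
      rw [show d + 1 - i = d - i + 1 by have := mem_range.1 hi; lia, pow_succ]
      ring
    rw [sum_range_succ', sum_congr rfl hpascal, sum_add_distrib, ← mul_sum, hsymm]
    simp only [Nat.choose_zero_right, pow_zero, Nat.cast_one, one_mul, Nat.sub_zero,
      eq_intCast, Int.cast_natCast]
    linear_combination hshift

/-- Subsets `T` of a fixed set `U` with at least `k` elements, weighted as the complements of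
the faces of a complex of dimension `N - k - 1`. -/
theorem sum_powerset_pow_mul_one_sub_pow {V : Type*} (U : Finset V)
    (N k : ℕ) (hk : 1 ≤ k) (hU : #U ≤ N) :
    ∑ T ∈ U.powerset, (if k ≤ #T then (X : Polynomial ℤ) ^ (N - #T) * (1 - X) ^ (#T - k) else 0) =
      X ^ (N - #U) * (if k ≤ #U then
        ∑ j ∈ range (#U - k + 1), C (((k - 1 + j).choose (k - 1) : ℤ)) * X ^ j else 0) := by
  rw [sum_powerset_apply_card
    (fun t => if k ≤ t then (X : Polynomial ℤ) ^ (N - t) * (1 - X) ^ (t - k) else 0)]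
  split_ifs with h
  · obtain ⟨d, hd⟩ := Nat.exists_eq_add_of_le' h
    rw [hd] at hU ⊢
    rw [Nat.add_sub_cancel, ← sum_range_choose_mul_pow_mul_one_sub_pow k d hk, ← sum_range_reflect,
      show d + k + 1 = d + 1 + k by lia, sum_range_add, mul_sum,
      add_eq_left.2]
    · refine sum_congr rfl fun i hi => ?_
      have hi := mem_range.1 hi
      rw [if_pos (by lia), show d + 1 + k - 1 - i = d + k - i by lia,
        Nat.choose_symm (by lia), nsmul_eq_mul,
        show N - (d + k - i) = N - (d + k) + i by lia, pow_add,
        show d + k - i - k = d - i by lia]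
      ring
    · refine sum_eq_zero fun i hi => ?_
      have hi := mem_range.1 hi
      rw [if_neg (by lia), smul_zero]
  · rw [mul_zero]
    refine sum_eq_zero fun i hi => ?_
    have hi := mem_range.1 hi
    rw [if_neg (by lia), smul_zero]

theorem induce_sum_top_connected_iff {α β : Type*} (S : Set (α ⊕ β)) :
    (((⊤ : SimpleGraph α) ⊕g (⊤ : SimpleGraph β)).induce S).Connected ↔
      S.Nonempty ∧ ((∀ v ∈ S, v.isLeft) ∨ ∀ v ∈ S, v.isRight) := by
  constructor
  · intro h
    refine ⟨Set.nonempty_coe_sort.1 h.nonempty, ?_⟩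
    have hside : ∀ u v : S, u.1.isLeft = v.1.isLeft := by
      intro u v
      obtain ⟨p⟩ := h.preconnected u v
      induction p with
      | nil => rfl
      | @cons a b c hab _ ih =>
        rw [← ih]
        rcases a with ⟨a | a, ha⟩ <;> rcases b with ⟨b | b, hb⟩ <;> simp_all
    obtain ⟨u⟩ := h.nonempty
    cases hu : u.1.isLeft
    · exact Or.inr fun v hv => Sum.not_isLeft.1 (by simp [← hside u ⟨v, hv⟩, hu])
    · exact Or.inl fun v hv => by rw [← hside u ⟨v, hv⟩, hu]
  · rintro ⟨hne, hS⟩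
    have : Nonempty S := hne.to_subtype
    refine ⟨fun u v => ?_⟩
    by_cases huv : u = v
    · rw [huv]
    · refine SimpleGraph.Adj.reachable ?_
      rcases u with ⟨a | a, ha⟩ <;> rcases v with ⟨b | b, hb⟩ <;> rcases hS with hS | hS <;>
        have h₁ := hS _ ha <;> have h₂ := hS _ hb <;> simp_all

theorem isCutFace_sum_top_iff {α β : Type*} [Fintype α] [Fintype β] [DecidableEq α]
    [DecidableEq β] (k : ℕ) (hk : 2 ≤ k) (σ : Finset (α ⊕ β)) :
    isCutFace ((⊤ : SimpleGraph α) ⊕g (⊤ : SimpleGraph β)) k σ ↔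
      k ≤ #σᶜ ∧ ¬ (∀ v ∈ σᶜ, v.isLeft) ∧ ¬ ∀ v ∈ σᶜ, v.isRight := by
  simp only [isCutFace, induce_sum_top_connected_iff]
  generalize σᶜ = T
  constructor
  · rintro ⟨S, hST, hS, h⟩
    have hne : (S : Set (α ⊕ β)).Nonempty := by
      rw [Finset.coe_nonempty, ← card_pos]
      lia
    exact ⟨hS ▸ card_le_card hST,
      fun hT => h ⟨hne, Or.inl fun v hv => hT v (hST hv)⟩,
      fun hT => h ⟨hne, Or.inr fun v hv => hT v (hST hv)⟩⟩
  · rintro ⟨hT, hl, hr⟩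
    push Not at hl hr
    obtain ⟨a, ha, ha'⟩ := hl
    obtain ⟨b, hb, hb'⟩ := hr
    obtain ⟨S, habS, hST, hS⟩ := exists_subsuperset_card_eq
      (s := {a, b}) (t := T) (n := k) (by simp [insert_subset_iff, ha, hb])
      (card_le_two.trans hk) hT
    refine ⟨S, hST, hS, ?_⟩
    rintro ⟨-, h | h⟩
    · exact ha' (h a (habS (by simp)))
    · exact hb' (h b (habS (by simp)))

theorem cutHPoly_sum_top {α β : Type*} [Fintype α] [Fintype β] [DecidableEq α] [DecidableEq β]
    (k : ℕ) (hk : 2 ≤ k) :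
    cutHPoly ((⊤ : SimpleGraph α) ⊕g (⊤ : SimpleGraph β)) k =
      ∑ T ∈ (univ : Finset (α ⊕ β)).powerset, (if k ≤ #T then
        X ^ (Fintype.card (α ⊕ β) - #T) * (1 - X) ^ (#T - k) else 0)
      - ∑ T ∈ ((univ : Finset (α ⊕ β)).filter fun v => v.isLeft).powerset, (if k ≤ #T then
        X ^ (Fintype.card (α ⊕ β) - #T) * (1 - X) ^ (#T - k) else 0)
      - ∑ T ∈ ((univ : Finset (α ⊕ β)).filter fun v => v.isRight).powerset, (if k ≤ #T then
        X ^ (Fintype.card (α ⊕ β) - #T) * (1 - X) ^ (#T - k) else 0) := by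
  classical
  have hpow (p : α ⊕ β → Prop) [DecidablePred p] :
      ((univ : Finset (α ⊕ β)).filter p).powerset = univ.filter fun T => ∀ v ∈ T, p v := by
    ext T
    simp [subset_iff]
  rw [cutHPoly, hpow, hpow, powerset_univ, sum_filter, sum_filter, sum_filter,
    ← sum_sub_distrib, ← sum_sub_distrib]
  refine Fintype.sum_bijective compl compl_bijective _ _ fun σ => ?_
  simp only [isCutFace_sum_top_iff k hk]
  have hσ : #σᶜ = Fintype.card (α ⊕ β) - #σ := card_compl σ
  have hle : #σ ≤ Fintype.card (α ⊕ β) := card_le_univ σ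
  by_cases hkσ : k ≤ #σᶜ
  · obtain ⟨v, hv⟩ := card_pos.1 (show 0 < #σᶜ by lia)
    rw [show Fintype.card (α ⊕ β) - k - #σ = #σᶜ - k by lia,
      show Fintype.card (α ⊕ β) - #σᶜ = #σ by lia]
    have hdisj : ¬ ((∀ v ∈ σᶜ, v.isLeft) ∧ ∀ v ∈ σᶜ, v.isRight) := by
      rintro ⟨hl, hr⟩
      have h₁ := hl v hv
      have h₂ := hr v hv
      cases v <;> simp_all
    rw [if_pos hkσ]
    by_cases hl : ∀ v ∈ σᶜ, v.isLeft = true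
    · rw [if_neg (by tauto), if_pos hl, if_neg (by tauto)]
      ring
    · by_cases hr : ∀ v ∈ σᶜ, v.isRight = true
      · rw [if_neg (by tauto), if_neg hl, if_pos hr]
        ring
      · rw [if_pos ⟨hkσ, hl, hr⟩, if_neg hl, if_neg hr]
        ring
  · simp [hkσ]

theorem hPolynomial_of_cut_complex_of_disjoint_complete_graphs (k m n : ℕ)
    (hk : 2 ≤ k) (hm : 1 ≤ m) (hn : 1 ≤ n) (hmn : k ≤ m + n) :
    cutHPoly ((⊤ : SimpleGraph (Fin m)) ⊕g (⊤ : SimpleGraph (Fin n))) k =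
      (∑ j ∈ Finset.range (m + n - k + 1), C (((k - 1 + j).choose (k - 1) : ℤ)) * X ^ j)
      - X ^ n * (if k ≤ m then
          ∑ j ∈ Finset.range (m - k + 1), C (((k - 1 + j).choose (k - 1) : ℤ)) * X ^ j else 0)
      - X ^ m * (if k ≤ n then
          ∑ j ∈ Finset.range (n - k + 1), C (((k - 1 + j).choose (k - 1) : ℤ)) * X ^ j else 0) := by
  have hl : #((univ : Finset (Fin m ⊕ Fin n)).filter fun v => v.isLeft) = m := by
    rw [card_filter, Fintype.sum_sum_type]
    simp
  have hr : #((univ : Finset (Fin m ⊕ Fin n)).filter fun v => v.isRight) = n := by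
    rw [card_filter, Fintype.sum_sum_type]
    simp
  have hc : Fintype.card (Fin m ⊕ Fin n) = m + n := by simp
  rw [cutHPoly_sum_top k hk,
    sum_powerset_pow_mul_one_sub_pow _ _ k (by lia) (card_le_univ _),
    sum_powerset_pow_mul_one_sub_pow _ _ k (by lia) (card_le_univ _),
    sum_powerset_pow_mul_one_sub_pow _ _ k (by lia) (card_le_univ _),
    hl, hr, card_univ, hc, if_pos hmn, Nat.sub_self, pow_zero, one_mul,
    Nat.add_sub_cancel_left, Nat.add_sub_cancel]
end

section
/- Let k ≥ 2 and m, n ≥ 1 with m + n > k. The reduced Euler characteristic of the k-cut complex of the disjoint union of two complete graphs satisfies χ̃(Δ_k(K_m+K_n)) = (−1)^{m+n−k−1} · ( C(m+n−1, k−1) − C(m−1, k−1) − C(n−1, k−1) ), where C(a,b) denotes the binomial coefficient (equal to 0 when b > a). -/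
open SimpleGraph Polynomial Finset

open Classical in
noncomputable def cutEuler {V : Type*} [Fintype V] [DecidableEq V] (G : SimpleGraph V) (k : ℕ) : ℤ :=
  ∑ σ ∈ Finset.univ.filter (fun σ => isCutFace G k σ), -(-1 : ℤ) ^ σ.card

namespace SimpleGraph

theorem connected_induce_completeGraph_sum_iff {V W : Type*} {S : Set (V ⊕ W)}
    (hS : S.Nonempty) :
    (((⊤ : SimpleGraph V) ⊕g (⊤ : SimpleGraph W)).induce S).Connected ↔
      ¬ ((∃ a, Sum.inl a ∈ S) ∧ ∃ b, Sum.inr b ∈ S) := by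
  constructor
  · rintro h ⟨⟨a, ha⟩, b, hb⟩
    exact not_reachable_sum_inl_inr a b
      ((h.preconnected ⟨_, ha⟩ ⟨_, hb⟩).map (Embedding.induce S).toHom)
  · intro h
    have := hS.to_subtype
    refine ⟨fun ⟨u, hu⟩ ⟨v, hv⟩ => ?_⟩
    by_cases huv : u = v
    · subst huv; rfl
    · refine Adj.reachable ?_
      rcases u with a | b <;> rcases v with c | d
      · simpa using huv
      · exact absurd ⟨⟨a, hu⟩, d, hv⟩ h
      · exact absurd ⟨⟨c, hv⟩, b, hu⟩ h
      · simpa using huv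

end SimpleGraph

theorem isCutFace_completeGraph_sum_iff {V W : Type*} [Fintype V] [DecidableEq V] [Fintype W]
    [DecidableEq W] {k : ℕ} (hk : 2 ≤ k) (σ : Finset (V ⊕ W)) :
    isCutFace ((⊤ : SimpleGraph V) ⊕g (⊤ : SimpleGraph W)) k σ ↔
      k ≤ #σᶜ ∧ (∃ a, Sum.inl a ∈ σᶜ) ∧ ∃ b, Sum.inr b ∈ σᶜ := by
  constructor
  · rintro ⟨S, hS, hcard, hdisc⟩
    have hne : (S : Set (V ⊕ W)).Nonempty := by
      rw [coe_nonempty, ← card_pos]; omega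
    rw [connected_induce_completeGraph_sum_iff hne, not_not] at hdisc
    obtain ⟨⟨a, ha⟩, b, hb⟩ := hdisc
    exact ⟨hcard ▸ card_le_card hS, ⟨a, hS ha⟩, b, hS hb⟩
  · rintro ⟨hcard, ⟨a, ha⟩, b, hb⟩
    obtain ⟨S, habS, hS, hScard⟩ := exists_subsuperset_card_eq
      (s := {Sum.inl a, Sum.inr b}) (t := σᶜ) (by grind) (card_le_two.trans hk) hcard
    have haS : Sum.inl a ∈ S := habS (by simp)
    have hbS : Sum.inr b ∈ S := habS (by simp)
    refine ⟨S, hS, hScard, ?_⟩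
    rw [connected_induce_completeGraph_sum_iff ⟨_, haS⟩, not_not]
    exact ⟨⟨a, haS⟩, b, hbS⟩

theorem Finset.sum_powerset_filter_lt_card_neg_one_pow {α : Type*} {s : Finset α}
    (hs : s.Nonempty) (d : ℕ) :
    ∑ t ∈ s.powerset with d < #t, (-1 : ℤ) ^ #t = (-1) ^ (d + 1) * (#s - 1).choose d := by
  obtain ⟨q, hq⟩ : ∃ q, #s = q + 1 := ⟨#s - 1, by have := hs.card_pos; omega⟩
  have hlevel (j : ℕ) :
      ∑ t ∈ s.powerset with #t = j, (-1 : ℤ) ^ #t = (-1) ^ j * (#s).choose j := by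
    rw [← powersetCard_eq_filter,
      sum_congr rfl fun t ht => by rw [(mem_powersetCard.1 ht).2], sum_const,
      card_powersetCard, nsmul_eq_mul, mul_comm]
  have hsplit (j : ℕ) : ∑ t ∈ s.powerset with j ≤ #t, (-1 : ℤ) ^ #t =
      (-1) ^ j * (#s).choose j + ∑ t ∈ s.powerset with j < #t, (-1 : ℤ) ^ #t := by
    rw [← hlevel j]
    simp only [sum_filter, ← sum_add_distrib]
    refine sum_congr rfl fun t _ => ?_
    rcases lt_trichotomy j #t with h | h | h
    · simp [h, h.le, h.ne']
    · simp [h]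
    · simp [h.not_ge, h.not_gt, h.ne]
  induction d with
  | zero =>
    have h := hsplit 0
    simp only [zero_le, filter_true, sum_powerset_neg_one_pow_card_of_nonempty hs] at h
    simp at h ⊢
    linarith
  | succ d ih =>
    have h := hsplit (d + 1)
    simp only [Nat.add_one_le_iff] at h
    rw [ih, hq, Nat.choose_succ_succ] at h
    rw [hq]
    push_cast at h ⊢
    rw [pow_succ _ (d + 1)]
    linarith

theorem reduced_euler_char_of_cut_complex_of_disjoint_complete_graphs (k m n : ℕ)
    (hk : 2 ≤ k) (hm : 1 ≤ m) (hn : 1 ≤ n) (hmn : k < m + n) :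
    cutEuler ((⊤ : SimpleGraph (Fin m)) ⊕g (⊤ : SimpleGraph (Fin n))) k =
      (-1) ^ (m + n - k - 1) *
        (((m + n - 1).choose (k - 1) : ℤ) - ((m - 1).choose (k - 1) : ℤ)
          - ((n - 1).choose (k - 1) : ℤ)) := by
  classical
  set L : Finset (Fin m ⊕ Fin n) := univ.map Function.Embedding.inl with hL
  set R : Finset (Fin m ⊕ Fin n) := univ.map Function.Embedding.inr with hR
  have hLcard : #L = m := by simp [hL]
  have hRcard : #R = n := by simp [hR]
  have hUcard : #(univ : Finset (Fin m ⊕ Fin n)) = m + n := by simp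
  have hsubL (t : Finset (Fin m ⊕ Fin n)) : t ⊆ L ↔ ¬ ∃ b, Sum.inr b ∈ t := by
    simp [hL, subset_iff]
  have hsubR (t : Finset (Fin m ⊕ Fin n)) : t ⊆ R ↔ ¬ ∃ a, Sum.inl a ∈ t := by
    simp [hR, subset_iff]
  obtain ⟨d, rfl⟩ : ∃ d, k = d + 1 := ⟨k - 1, by omega⟩
  have hpow (s : Finset (Fin m ⊕ Fin n)) : ∑ t ∈ s.powerset with d < #t, (-1 : ℤ) ^ #t =
      ∑ t, if t ⊆ s ∧ d < #t then (-1 : ℤ) ^ #t else 0 := by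
    rw [← sum_filter]
    congr 1
    ext t
    simp
  have hcompl : cutEuler ((⊤ : SimpleGraph (Fin m)) ⊕g (⊤ : SimpleGraph (Fin n))) (d + 1) =
      -(-1) ^ (m + n) * ∑ t ∈ (univ : Finset (Finset (Fin m ⊕ Fin n))) with
        d < #t ∧ (∃ a, Sum.inl a ∈ t) ∧ ∃ b, Sum.inr b ∈ t, (-1 : ℤ) ^ #t := by
    rw [cutEuler, mul_sum]
    refine sum_bij' (fun σ _ => σᶜ) (fun t _ => tᶜ) ?_ ?_ ?_ ?_ ?_
    · intro σ hσ
      simpa [isCutFace_completeGraph_sum_iff hk] using hσ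
    · intro t ht
      rw [mem_filter, isCutFace_completeGraph_sum_iff hk, compl_compl]
      simpa [Nat.add_one_le_iff] using ht
    · simp
    · simp
    · intro σ _
      have hc : #σ + #σᶜ = m + n := by rw [card_add_card_compl σ]; simp
      rw [← hc, pow_add, neg_mul, mul_assoc, ← mul_pow]
      simp
  have hincl : ∑ t ∈ (univ : Finset (Finset (Fin m ⊕ Fin n))) with
        d < #t ∧ (∃ a, Sum.inl a ∈ t) ∧ ∃ b, Sum.inr b ∈ t, (-1 : ℤ) ^ #t =
      ∑ t ∈ (univ : Finset (Fin m ⊕ Fin n)).powerset with d < #t, (-1 : ℤ) ^ #t -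
        ∑ t ∈ L.powerset with d < #t, (-1 : ℤ) ^ #t -
        ∑ t ∈ R.powerset with d < #t, (-1 : ℤ) ^ #t := by
    rw [hpow, hpow, hpow, sum_filter, ← sum_sub_distrib, ← sum_sub_distrib]
    refine sum_congr rfl fun t _ => ?_
    simp only [hsubL, hsubR]
    by_cases hd : d < #t
    · obtain ⟨x, hx⟩ := card_pos.1 (Nat.zero_lt_of_lt hd)
      have hor : (∃ a, Sum.inl a ∈ t) ∨ ∃ b, Sum.inr b ∈ t := by
        rcases x with a | b
        · exact .inl ⟨a, hx⟩
        · exact .inr ⟨b, hx⟩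
      by_cases hl : ∃ a, Sum.inl a ∈ t <;> by_cases hr : ∃ b, Sum.inr b ∈ t <;>
        simp only [hd, hl, hr, subset_univ, and_self, and_true, and_false, not_true,
          not_false_eq_true, if_true, if_false] <;> first | exact absurd hor (by tauto) | ring
    · simp [hd]
  rw [hcompl, hincl, sum_powerset_filter_lt_card_neg_one_pow (card_pos.1 (by omega)),
    sum_powerset_filter_lt_card_neg_one_pow (card_pos.1 (by omega)),
    sum_powerset_filter_lt_card_neg_one_pow (card_pos.1 (by omega)), hLcard, hRcard, hUcard]
  obtain ⟨e, he⟩ : ∃ e, m + n = d + 2 + e := ⟨m + n - (d + 2), by omega⟩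
  have hexp : m + n - (d + 1) - 1 = e := by omega
  have hsign : (-1 : ℤ) ^ (m + n) * (-1) ^ (d + 1) = -(-1) ^ e := by
    rw [he, ← pow_add, show d + 2 + e + (d + 1) = 2 * (d + 1) + (e + 1) by ring, pow_add, pow_mul]
    simp [pow_succ]
  rw [hexp, Nat.add_sub_cancel]
  linear_combination (-(((m + n - 1).choose d : ℤ) - ((m - 1).choose d : ℤ)
    - ((n - 1).choose d : ℤ))) * hsign
end
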